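/- arXiv:1904.07049 — 2 statements merged into one kernel-verified Lean document; each statement's English description precedes it below -/
import Mathlib

section
/- The vectorized bilinear form a(v,φ) = a(v₁,φ₂) + a(φ₁,v₂) on V × V has the same continuity and inf-sup constants as a : V₁ × V₂ → ℝ, namely sup over nonzero v, φ ∈ V of |a(v,φ)|/(‖v‖·‖φ‖) = M_a and inf over nonzero v ∈ V of sup over nonzero φ ∈ V of a(v,φ)/(‖v‖·‖φ‖) = m_a. -/
open scoped RealInnerProductSpace
open Filter Topology

noncomputable section Setup

variable {V₁ V₂ Q W : Type*}
  [NormedAddCommGroup V₁] [InnerProductSpace ℝ V₁]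
  [NormedAddCommGroup V₂] [InnerProductSpace ℝ V₂]
  [NormedAddCommGroup Q] [InnerProductSpace ℝ Q]
  [NormedAddCommGroup W] [InnerProductSpace ℝ W]

/-- The ℓ²-norm on the product space `V = V₁ × V₂`. -/
def nV (v : V₁ × V₂) : ℝ := Real.sqrt (‖v.1‖ ^ 2 + ‖v.2‖ ^ 2)

/-- The seminorm `|v| = (‖I v₁‖² + ‖C* v₂‖²)^{1/2}`. -/
def sV (Cs : V₂ →L[ℝ] Q) (Iop : V₁ →L[ℝ] W) (v : V₁ × V₂) : ℝ :=
  Real.sqrt (‖Iop v.1‖ ^ 2 + ‖Cs v.2‖ ^ 2)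

/-- The vectorized bilinear form `a(v,φ) = a(v₁,φ₂) + a(φ₁,v₂)` on `V × V`. -/
def aV (a : V₁ →L[ℝ] V₂ →L[ℝ] ℝ) (v φ : V₁ × V₂) : ℝ := a v.1 φ.2 + a φ.1 v.2

/-- The bilinear form `b = a + α^{-1/2} c` of the rescaled reduced optimality system. -/
def bV (a : V₁ →L[ℝ] V₂ →L[ℝ] ℝ) (Cs : V₂ →L[ℝ] Q) (Iop : V₁ →L[ℝ] W) (α : ℝ)
    (v φ : V₁ × V₂) : ℝ :=
  aV a v φ + (Real.sqrt α)⁻¹ * (⟪Cs v.2, Cs φ.2⟫ - ⟪Iop v.1, Iop φ.1⟫)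

/-- Continuity constant `M_a = sup { a(v₁,v₂) : ‖v₁‖ = 1, ‖v₂‖ = 1 }`. -/
def contConst (a : V₁ →L[ℝ] V₂ →L[ℝ] ℝ) : ℝ :=
  sSup {r : ℝ | ∃ v₁ : V₁, ∃ v₂ : V₂, ‖v₁‖ = 1 ∧ ‖v₂‖ = 1 ∧ r = a v₁ v₂}

/-- Inf-sup constant `m_a = inf_{‖v₂‖=1} sup_{‖v₁‖=1} a(v₁,v₂)`. -/
def infSupConst (a : V₁ →L[ℝ] V₂ →L[ℝ] ℝ) : ℝ :=
  sInf {r : ℝ | ∃ v₂ : V₂, ‖v₂‖ = 1 ∧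
    r = sSup {s : ℝ | ∃ v₁ : V₁, ‖v₁‖ = 1 ∧ s = a v₁ v₂}}

/-- The α-dependent test norm `‖φ‖_α = M_a ‖φ‖ + (M/√α) |φ|`. -/
def nAlpha (Cs : V₂ →L[ℝ] Q) (Iop : V₁ →L[ℝ] W) (M_a M α : ℝ) (φ : V₁ × V₂) : ℝ :=
  M_a * nV φ + (M / Real.sqrt α) * sV Cs Iop φ

end Setup

section ProductNorm

variable {V₁ V₂ : Type*} [NormedAddCommGroup V₁] [NormedAddCommGroup V₂]

theorem nV_nonneg (v : V₁ × V₂) : 0 ≤ nV v := Real.sqrt_nonneg _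

theorem nV_sq (v : V₁ × V₂) : nV v ^ 2 = ‖v.1‖ ^ 2 + ‖v.2‖ ^ 2 :=
  Real.sq_sqrt (by positivity)

theorem nV_pos {v : V₁ × V₂} (hv : v ≠ 0) : 0 < nV v := by
  refine Real.sqrt_pos.2 ?_
  have h : v.1 ≠ 0 ∨ v.2 ≠ 0 := by
    contrapose! hv
    exact Prod.ext hv.1 hv.2
  rcases h with h | h
  · have := norm_pos_iff.2 h
    positivity
  · have := norm_pos_iff.2 h
    positivity

theorem nV_mk_zero (x : V₁) : nV (x, (0 : V₂)) = ‖x‖ := by simp [nV]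

theorem nV_zero_mk (y : V₂) : nV ((0 : V₁), y) = ‖y‖ := by simp [nV]

theorem norm_fst_le_nV (v : V₁ × V₂) : ‖v.1‖ ≤ nV v :=
  Real.le_sqrt_of_sq_le (by nlinarith [sq_nonneg ‖v.2‖])

theorem cross_le_nV_mul_nV (v φ : V₁ × V₂) :
    ‖v.1‖ * ‖φ.2‖ + ‖φ.1‖ * ‖v.2‖ ≤ nV v * nV φ := by
  refine abs_le_of_sq_le_sq' ?_ (mul_nonneg (nV_nonneg v) (nV_nonneg φ)) |>.2
  rw [mul_pow, nV_sq, nV_sq]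
  nlinarith [sq_nonneg (‖v.1‖ * ‖φ.1‖ - ‖v.2‖ * ‖φ.2‖)]

end ProductNorm

section ContinuityConstant

variable {V₁ V₂ : Type*}
  [NormedAddCommGroup V₁] [InnerProductSpace ℝ V₁]
  [NormedAddCommGroup V₂] [InnerProductSpace ℝ V₂]

theorem le_contConst_mul (a : V₁ →L[ℝ] V₂ →L[ℝ] ℝ) (x : V₁) (y : V₂) :
    a x y ≤ contConst a * (‖x‖ * ‖y‖) := by
  rcases eq_or_ne x 0 with rfl | hx
  · simp
  rcases eq_or_ne y 0 with rfl | hy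
  · simp
  have hx' := norm_pos_iff.2 hx
  have hy' := norm_pos_iff.2 hy
  have hbdd : BddAbove {r : ℝ | ∃ v₁ : V₁, ∃ v₂ : V₂, ‖v₁‖ = 1 ∧ ‖v₂‖ = 1 ∧ r = a v₁ v₂} := by
    refine ⟨‖a‖, ?_⟩
    rintro _ ⟨v, w, hv, hw, rfl⟩
    simpa [hv, hw] using (le_abs_self _).trans (a.le_opNorm₂ v w)
  have h : a (‖x‖⁻¹ • x) (‖y‖⁻¹ • y) ≤ contConst a :=
    le_csSup hbdd ⟨_, _, norm_smul_inv_norm (𝕜 := ℝ) hx, norm_smul_inv_norm (𝕜 := ℝ) hy, rfl⟩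
  have h' : a x y = a (‖x‖⁻¹ • x) (‖y‖⁻¹ • y) * (‖x‖ * ‖y‖) := by
    simp only [map_smul, smul_apply, smul_eq_mul]
    field_simp
  rw [h']
  gcongr

theorem abs_le_contConst_mul (a : V₁ →L[ℝ] V₂ →L[ℝ] ℝ) (x : V₁) (y : V₂) :
    |a x y| ≤ contConst a * (‖x‖ * ‖y‖) := by
  refine abs_le'.2 ⟨le_contConst_mul a x y, ?_⟩
  simpa using le_contConst_mul a (-x) y

theorem contConst_nonneg [Nontrivial V₁] [Nontrivial V₂] (a : V₁ →L[ℝ] V₂ →L[ℝ] ℝ) :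
    0 ≤ contConst a := by
  obtain ⟨x, hx⟩ := exists_norm_eq V₁ zero_le_one
  obtain ⟨y, hy⟩ := exists_norm_eq V₂ zero_le_one
  simpa [hx, hy] using (abs_nonneg _).trans (abs_le_contConst_mul a x y)

theorem abs_aV_div_le_contConst [Nontrivial V₁] [Nontrivial V₂]
    (a : V₁ →L[ℝ] V₂ →L[ℝ] ℝ) (v φ : V₁ × V₂) :
    |aV a v φ| / (nV v * nV φ) ≤ contConst a := by
  have h0 := contConst_nonneg a
  refine div_le_of_le_mul₀ (mul_nonneg (nV_nonneg v) (nV_nonneg φ)) h0 ?_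
  calc |aV a v φ| ≤ |a v.1 φ.2| + |a φ.1 v.2| := abs_add_le _ _
    _ ≤ contConst a * (‖v.1‖ * ‖φ.2‖) + contConst a * (‖φ.1‖ * ‖v.2‖) :=
      add_le_add (abs_le_contConst_mul a _ _) (abs_le_contConst_mul a _ _)
    _ = contConst a * (‖v.1‖ * ‖φ.2‖ + ‖φ.1‖ * ‖v.2‖) := by ring
    _ ≤ contConst a * (nV v * nV φ) := by
      gcongr
      exact cross_le_nV_mul_nV v φ

theorem sSup_abs_aV_eq_contConst [Nontrivial V₁] [Nontrivial V₂]
    (a : V₁ →L[ℝ] V₂ →L[ℝ] ℝ) :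
    sSup {r : ℝ | ∃ v φ : V₁ × V₂, v ≠ 0 ∧ φ ≠ 0 ∧
      r = |aV a v φ| / (nV v * nV φ)} = contConst a := by
  have hub : contConst a ∈ upperBounds {r : ℝ | ∃ v φ : V₁ × V₂, v ≠ 0 ∧ φ ≠ 0 ∧
      r = |aV a v φ| / (nV v * nV φ)} := by
    rintro _ ⟨v, φ, -, -, rfl⟩
    exact abs_aV_div_le_contConst a v φ
  obtain ⟨v, hv⟩ := exists_ne (0 : V₁ × V₂)
  refine le_antisymm (csSup_le ⟨_, v, v, hv, hv, rfl⟩ hub) ?_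
  obtain ⟨x, hx⟩ := exists_norm_eq V₁ zero_le_one
  obtain ⟨y, hy⟩ := exists_norm_eq V₂ zero_le_one
  refine csSup_le ⟨_, x, y, hx, hy, rfl⟩ ?_
  rintro _ ⟨x, y, hx, hy, rfl⟩
  have hx0 : x ≠ 0 := norm_ne_zero_iff.1 (by simp [hx])
  have hy0 : y ≠ 0 := norm_ne_zero_iff.1 (by simp [hy])
  refine (le_abs_self _).trans (le_csSup ⟨_, hub⟩ ⟨(x, 0), (0, y), ?_, ?_, ?_⟩)
  · simp [hx0]
  · simp [hy0]
  · simp [nV_mk_zero, nV_zero_mk, hx, hy, aV]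

end ContinuityConstant

section RieszOperator

variable {V₁ V₂ : Type*}
  [NormedAddCommGroup V₁] [InnerProductSpace ℝ V₁]
  [NormedAddCommGroup V₂] [InnerProductSpace ℝ V₂]

theorem exists_riesz_operator [CompleteSpace V₁] (a : V₁ →L[ℝ] V₂ →L[ℝ] ℝ) :
    ∃ T : V₂ →L[ℝ] V₁, ∀ x y, ⟪T y, x⟫ = a x y := by
  have key (x : V₁) (y : V₂) :
      ⟪(InnerProductSpace.toDual ℝ V₁).symm (a.flip y), x⟫ = a x y := by
    simp [InnerProductSpace.toDual_symm_apply]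
  refine ⟨LinearMap.mkContinuous
    { toFun := fun y => (InnerProductSpace.toDual ℝ V₁).symm (a.flip y)
      map_add' := fun y z => by rw [map_add, map_add]
      map_smul' := fun c y => by simp } ‖a.flip‖ fun y => ?_, key⟩
  simpa using a.flip.le_opNorm y

theorem sSup_unit_eq_norm_riesz [Nontrivial V₁] {a : V₁ →L[ℝ] V₂ →L[ℝ] ℝ} {T : V₂ →L[ℝ] V₁}
    (hT : ∀ x y, ⟪T y, x⟫ = a x y) (y : V₂) :
    sSup {s : ℝ | ∃ x : V₁, ‖x‖ = 1 ∧ s = a x y} = ‖T y‖ := by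
  refine IsGreatest.csSup_eq ⟨?_, ?_⟩
  · rcases eq_or_ne (T y) 0 with h | h
    · obtain ⟨x, hx⟩ := exists_norm_eq V₁ zero_le_one
      exact ⟨x, hx, by rw [← hT, h]; simp⟩
    · refine ⟨‖T y‖⁻¹ • T y, norm_smul_inv_norm (𝕜 := ℝ) h, ?_⟩
      have := norm_ne_zero_iff.2 h
      rw [← hT, inner_smul_right, real_inner_self_eq_norm_sq]
      field_simp
  · rintro _ ⟨x, hx, rfl⟩
    rw [← hT]
    simpa [hx] using real_inner_le_norm (T y) x

theorem infSupConst_mul_norm_le [Nontrivial V₁] {a : V₁ →L[ℝ] V₂ →L[ℝ] ℝ} {T : V₂ →L[ℝ] V₁}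
    (hT : ∀ x y, ⟪T y, x⟫ = a x y) (y : V₂) : infSupConst a * ‖y‖ ≤ ‖T y‖ := by
  rcases eq_or_ne y 0 with rfl | hy
  · simp
  have hy' := norm_pos_iff.2 hy
  have hbdd : BddBelow {r : ℝ | ∃ v₂ : V₂, ‖v₂‖ = 1 ∧
      r = sSup {s : ℝ | ∃ v₁ : V₁, ‖v₁‖ = 1 ∧ s = a v₁ v₂}} := by
    refine ⟨0, ?_⟩
    rintro _ ⟨v, -, rfl⟩
    rw [sSup_unit_eq_norm_riesz hT]
    exact norm_nonneg _
  have h : infSupConst a ≤ ‖T (‖y‖⁻¹ • y)‖ :=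
    csInf_le hbdd ⟨_, norm_smul_inv_norm (𝕜 := ℝ) hy, (sSup_unit_eq_norm_riesz hT _).symm⟩
  rwa [map_smul, norm_smul, norm_inv, norm_norm, inv_mul_eq_div, le_div_iff₀ hy'] at h

variable [CompleteSpace V₁] [CompleteSpace V₂]

theorem riesz_operator_surjective {a : V₁ →L[ℝ] V₂ →L[ℝ] ℝ} {T : V₂ →L[ℝ] V₁}
    (hT : ∀ x y, ⟪T y, x⟫ = a x y) {m : ℝ} (hm : 0 < m) (hbound : ∀ y, m * ‖y‖ ≤ ‖T y‖)
    (hnd : ∀ x : V₁, (∀ y : V₂, a x y = 0) → x = 0) : Function.Surjective T := by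
  have hanti : AntilipschitzWith (Real.toNNReal m⁻¹) T := by
    refine ContinuousLinearMap.antilipschitz_of_bound T fun y => ?_
    rw [Real.coe_toNNReal _ (inv_nonneg.2 hm.le), inv_mul_eq_div, le_div_iff₀ hm, mul_comm]
    exact hbound y
  have hclosed : IsClosed (LinearMap.range T.toLinearMap : Set V₁) := by
    rw [LinearMap.coe_range]
    exact hanti.isClosed_range T.uniformContinuous
  have : CompleteSpace (LinearMap.range T.toLinearMap) := hclosed.completeSpace_coe
  refine LinearMap.range_eq_top.1 (Submodule.orthogonal_eq_bot_iff.1 ?_)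
  refine (Submodule.eq_bot_iff _).2 fun x hx => hnd x fun y => ?_
  rw [← hT]
  exact (Submodule.mem_orthogonal _ _).1 hx _ ⟨y, rfl⟩

theorem exists_aV_ge {a : V₁ →L[ℝ] V₂ →L[ℝ] ℝ} {T : V₂ →L[ℝ] V₁}
    (hT : ∀ x y, ⟪T y, x⟫ = a x y) {m : ℝ} (hm : 0 < m) (hbound : ∀ y, m * ‖y‖ ≤ ‖T y‖)
    (hnd : ∀ x : V₁, (∀ y : V₂, a x y = 0) → x = 0) {v : V₁ × V₂} (hv : v ≠ 0) :
    ∃ φ : V₁ × V₂, φ ≠ 0 ∧ m ≤ aV a v φ / (nV v * nV φ) := by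
  obtain ⟨y, hy⟩ := riesz_operator_surjective hT hm hbound hnd v.1
  have hvpos := nV_pos hv
  set φ : V₁ × V₂ := ((‖v.2‖ / ‖T v.2‖) • T v.2, m • y) with hφ
  have h1 : ‖φ.1‖ ≤ ‖v.2‖ := by
    rw [hφ, norm_smul, norm_div, norm_norm, norm_norm]
    rw [div_mul_comm]
    exact mul_le_of_le_one_left (norm_nonneg _) (div_self_le_one _)
  have h2 : ‖φ.2‖ ≤ ‖v.1‖ := by
    rw [hφ, norm_smul, Real.norm_of_nonneg hm.le, ← hy]
    exact hbound y
  have hle : nV φ ≤ nV v := by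
    rw [nV, nV, add_comm]
    gcongr
  have ha1 : a v.1 φ.2 = m * ‖v.1‖ ^ 2 := by
    rw [← hT, hφ, map_smul, hy, inner_smul_left, real_inner_self_eq_norm_sq]
    rfl
  have ha2 : m * ‖v.2‖ ^ 2 ≤ a φ.1 v.2 := by
    have : a φ.1 v.2 = ‖v.2‖ * ‖T v.2‖ := by
      rw [← hT, hφ, inner_smul_right, real_inner_self_eq_norm_sq]
      rcases eq_or_ne ‖T v.2‖ 0 with h | h
      · simp [h]
      · field_simp
    rw [this]
    nlinarith [hbound v.2, norm_nonneg v.2]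
  have hge : m * nV v ^ 2 ≤ aV a v φ := by
    rw [nV_sq, aV, ha1, mul_add]
    gcongr
  have hφ0 : φ ≠ 0 := by
    intro h
    have : aV a v φ = 0 := by simp [h, aV]
    have := mul_pos hm (pow_pos hvpos 2)
    linarith
  refine ⟨φ, hφ0, (le_div_iff₀ (mul_pos hvpos (nV_pos hφ0))).2 (le_trans ?_ hge)⟩
  rw [sq]
  gcongr

theorem sInf_sSup_aV_eq_infSupConst [Nontrivial V₁] [Nontrivial V₂]
    {a : V₁ →L[ℝ] V₂ →L[ℝ] ℝ} (hm : 0 < infSupConst a)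
    (hnd : ∀ x : V₁, (∀ y : V₂, a x y = 0) → x = 0) :
    sInf {r : ℝ | ∃ v : V₁ × V₂, v ≠ 0 ∧
      r = sSup {s : ℝ | ∃ φ : V₁ × V₂, φ ≠ 0 ∧
        s = aV a v φ / (nV v * nV φ)}} = infSupConst a := by
  obtain ⟨T, hT⟩ := exists_riesz_operator a
  have hbound := infSupConst_mul_norm_le hT
  have hlb : infSupConst a ∈ lowerBounds {r : ℝ | ∃ v : V₁ × V₂, v ≠ 0 ∧
      r = sSup {s : ℝ | ∃ φ : V₁ × V₂, φ ≠ 0 ∧ s = aV a v φ / (nV v * nV φ)}} := by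
    rintro _ ⟨v, hv, rfl⟩
    obtain ⟨φ, hφ, h⟩ := exists_aV_ge hT hm hbound hnd hv
    refine h.trans (le_csSup ⟨contConst a, ?_⟩ ⟨φ, hφ, rfl⟩)
    rintro _ ⟨ψ, -, rfl⟩
    refine le_trans ?_ (abs_aV_div_le_contConst a v ψ)
    exact div_le_div_of_nonneg_right (le_abs_self _) (mul_nonneg (nV_nonneg v) (nV_nonneg ψ))
  obtain ⟨v, hv⟩ := exists_ne (0 : V₁ × V₂)
  refine le_antisymm ?_ (le_csInf ⟨_, v, hv, rfl⟩ hlb)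
  obtain ⟨y, hy⟩ := exists_norm_eq V₂ zero_le_one
  refine le_csInf ⟨_, y, hy, rfl⟩ ?_
  rintro _ ⟨y, hy, rfl⟩
  have hy0 : y ≠ 0 := norm_ne_zero_iff.1 (by simp [hy])
  refine (csInf_le ⟨_, hlb⟩ ⟨((0 : V₁), y), by simp [hy0], rfl⟩).trans ?_
  rw [sSup_unit_eq_norm_riesz hT]
  refine csSup_le ⟨_, v, hv, rfl⟩ ?_
  rintro _ ⟨φ, -, rfl⟩
  refine div_le_of_le_mul₀ (mul_nonneg (nV_nonneg _) (nV_nonneg φ)) (norm_nonneg _) ?_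
  rw [nV_zero_mk, hy, one_mul]
  calc aV a (0, y) φ = ⟪T y, φ.1⟫ := by simp [aV, hT]
    _ ≤ ‖T y‖ * ‖φ.1‖ := real_inner_le_norm _ _
    _ ≤ ‖T y‖ * nV φ := by
      gcongr
      exact norm_fst_le_nV φ

end RieszOperator

/-- the vectorized bilinear form on `V × V` has the same continuity
constant `M_a` and inf-sup constant `m_a` as `a : V₁ × V₂ → ℝ`. -/
theorem stmt1
    {V₁ V₂ : Type*}
    [NormedAddCommGroup V₁] [InnerProductSpace ℝ V₁] [CompleteSpace V₁] [Nontrivial V₁]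
    [NormedAddCommGroup V₂] [InnerProductSpace ℝ V₂] [CompleteSpace V₂] [Nontrivial V₂]
    (a : V₁ →L[ℝ] V₂ →L[ℝ] ℝ)
    (M_a m_a : ℝ)
    (hMa : M_a = contConst a)
    (hma : m_a = infSupConst a) (hma_pos : 0 < m_a)
    (hnd : ∀ v₁ : V₁, (∀ v₂ : V₂, a v₁ v₂ = 0) → v₁ = 0) :
    sSup {r : ℝ | ∃ v φ : V₁ × V₂, v ≠ 0 ∧ φ ≠ 0 ∧
        r = |aV a v φ| / (nV v * nV φ)} = M_a ∧
    sInf {r : ℝ | ∃ v : V₁ × V₂, v ≠ 0 ∧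
        r = sSup {s : ℝ | ∃ φ : V₁ × V₂, φ ≠ 0 ∧
          s = aV a v φ / (nV v * nV φ)}} = m_a := by
  subst hMa hma
  exact ⟨sSup_abs_aV_eq_contConst a, sInf_sSup_aV_eq_infSupConst hma_pos hnd⟩
end

section
/- For every u_d ∈ W there exists a unique x ∈ V such that b(x,φ) = −α^{−1/2}·⟨u_d, Iφ₁⟩_W for all φ = (φ₁,φ₂) ∈ V (unique solvability of the rescaled and reduced optimality system). -/
open scoped RealInnerProductSpace
open Filter Topology

/-- A continuous linear map between Hilbert spaces which is bounded below and whose range has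
trivial orthogonal complement is a continuous linear equivalence. -/
theorem exists_continuousLinearEquiv_of_bounded_below {E F : Type*}
    [NormedAddCommGroup E] [InnerProductSpace ℝ E] [CompleteSpace E]
    [NormedAddCommGroup F] [InnerProductSpace ℝ F] [CompleteSpace F]
    (A : E →L[ℝ] F) {m : ℝ} (hm : 0 < m) (hA : ∀ v, m * ‖v‖ ≤ ‖A v‖)
    (horth : ∀ w, (∀ v, ⟪A v, w⟫ = 0) → w = 0) :
    ∃ e : E ≃L[ℝ] F, ∀ v, e v = A v := by
  have hanti : AntilipschitzWith ⟨m⁻¹, (inv_pos.2 hm).le⟩ A := by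
    refine A.antilipschitz_of_bound fun v => ?_
    change ‖v‖ ≤ m⁻¹ * ‖A v‖
    rw [inv_mul_eq_div, le_div_iff₀ hm, mul_comm]
    exact hA v
  have hker : A.ker = ⊥ := LinearMap.ker_eq_bot.2 hanti.injective
  have hclosed : IsClosed (A.range : Set F) := hanti.isClosed_range A.uniformContinuous
  have hrange : A.range = ⊤ := by
    have := hclosed.completeSpace_coe
    rw [← Submodule.orthogonal_eq_bot_iff, Submodule.eq_bot_iff]
    intro w hw
    exact horth w fun v => (Submodule.mem_orthogonal _ w).1 hw (A v) ⟨v, rfl⟩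
  exact ⟨ContinuousLinearEquiv.ofBijective A hker hrange, fun v => rfl⟩

/-- For a bounded operator `L` between Hilbert spaces and real `t`, the operator
`1 + t² L* L` is surjective. -/
theorem exists_add_sq_smul_adjoint_apply_eq {E F : Type*}
    [NormedAddCommGroup E] [InnerProductSpace ℝ E] [CompleteSpace E]
    [NormedAddCommGroup F] [InnerProductSpace ℝ F] [CompleteSpace F]
    (L : E →L[ℝ] F) (t : ℝ) (u : E) :
    ∃ y, y + t ^ 2 • L.adjoint (L y) = u := by
  let G : E →L[ℝ] E := ContinuousLinearMap.id ℝ E + t ^ 2 • (L.adjoint ∘L L)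
  have hG : IsCoercive ((innerSL ℝ) ∘L G : E →L[ℝ] E →L[ℝ] ℝ) := by
    refine ⟨1, one_pos, fun v => ?_⟩
    have h : ⟪G v, v⟫ = ‖v‖ ^ 2 + t ^ 2 * ‖L v‖ ^ 2 := by
      simp [G, inner_add_left, real_inner_smul_left, ContinuousLinearMap.adjoint_inner_left]
    change 1 * ‖v‖ * ‖v‖ ≤ ⟪G v, v⟫
    rw [h]
    have : 0 ≤ t ^ 2 * ‖L v‖ ^ 2 := by positivity
    linarith [sq ‖v‖]
  refine ⟨hG.continuousLinearEquivOfBilin.symm u, ?_⟩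
  refine ext_inner_right ℝ fun w => ?_
  have h := hG.continuousLinearEquivOfBilin_apply (hG.continuousLinearEquivOfBilin.symm u) w
  rw [ContinuousLinearEquiv.apply_symm_apply] at h
  exact h.symm

/-- The inf-sup constant bounds the operator representing `a` from below. -/
theorem infSupConst_mul_norm_le_s2 {V₁ V₂ : Type*}
    [NormedAddCommGroup V₁] [InnerProductSpace ℝ V₁]
    [NormedAddCommGroup V₂] [InnerProductSpace ℝ V₂]
    (a : V₁ →L[ℝ] V₂ →L[ℝ] ℝ) (h : 0 < infSupConst a) (v : V₂) :
    infSupConst a * ‖v‖ ≤ ‖a.flip v‖ := by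
  rcases eq_or_ne v 0 with rfl | hv
  · simp
  have hv' : 0 < ‖v‖ := norm_pos_iff.2 hv
  have hbdd : BddBelow {r : ℝ | ∃ v₂ : V₂, ‖v₂‖ = 1 ∧
      r = sSup {s : ℝ | ∃ v₁ : V₁, ‖v₁‖ = 1 ∧ s = a v₁ v₂}} := by
    by_contra hb
    exact h.ne' (Real.sInf_of_not_bddBelow hb)
  have hunit : ‖‖v‖⁻¹ • v‖ = 1 := by
    rw [norm_smul, norm_inv, norm_norm, inv_mul_cancel₀ hv'.ne']
  have h₁ : infSupConst a ≤ ‖a.flip (‖v‖⁻¹ • v)‖ := by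
    refine (csInf_le hbdd ⟨_, hunit, rfl⟩).trans (Real.sSup_le ?_ (norm_nonneg _))
    rintro _ ⟨v₁, hv₁, rfl⟩
    have h₂ := (a.flip (‖v‖⁻¹ • v)).le_opNorm v₁
    rw [hv₁, mul_one] at h₂
    exact (le_abs_self _).trans h₂
  rwa [map_smul, norm_smul, norm_inv, norm_norm, inv_mul_eq_div, le_div_iff₀ hv'] at h₁

/-- Corollary 2.5, existence and uniqueness: for every desired state
`u_d` the rescaled and reduced optimality system has a unique solution. -/
theorem stmt2
    {V₁ V₂ Q W : Type*}
    [NormedAddCommGroup V₁] [InnerProductSpace ℝ V₁] [CompleteSpace V₁] [Nontrivial V₁]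
    [NormedAddCommGroup V₂] [InnerProductSpace ℝ V₂] [CompleteSpace V₂] [Nontrivial V₂]
    [NormedAddCommGroup Q] [InnerProductSpace ℝ Q] [CompleteSpace Q]
    [NormedAddCommGroup W] [InnerProductSpace ℝ W] [CompleteSpace W]
    (a : V₁ →L[ℝ] V₂ →L[ℝ] ℝ) (Cs : V₂ →L[ℝ] Q) (Iop : V₁ →L[ℝ] W)
    (α m_a : ℝ) (hα : 0 < α)
    (hma : m_a = infSupConst a) (hma_pos : 0 < m_a)
    (hnd : ∀ v₁ : V₁, (∀ v₂ : V₂, a v₁ v₂ = 0) → v₁ = 0) :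
    ∀ u_d : W, ∃! x : V₁ × V₂, ∀ φ : V₁ × V₂,
      bV a Cs Iop α x φ = -(Real.sqrt α)⁻¹ * ⟪u_d, Iop φ.1⟫ := by
  intro u
  subst hma
  have ht : 0 < (Real.sqrt α)⁻¹ := inv_pos.2 (Real.sqrt_pos.2 hα)
  have hbelow := infSupConst_mul_norm_le_s2 a hma_pos
  simp only [bV, aV]
  generalize (Real.sqrt α)⁻¹ = t at ht ⊢
  refine existsUnique_of_exists_of_unique ?_ ?_
  · let A : V₂ →L[ℝ] V₁ :=
      { toFun := fun v => (InnerProductSpace.toDual ℝ V₁).symm (a.flip v)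
        map_add' := fun v w => by simp
        map_smul' := fun r v => by simp
        cont := (InnerProductSpace.toDual ℝ V₁).symm.continuous.comp a.flip.continuous }
    have hA : ∀ v₂ v₁, ⟪A v₂, v₁⟫ = a v₁ v₂ := fun v₂ v₁ =>
      InnerProductSpace.toDual_symm_apply
    obtain ⟨e, he⟩ := exists_continuousLinearEquiv_of_bounded_below A hma_pos
      (fun v => (hbelow v).trans_eq
        ((InnerProductSpace.toDual ℝ V₁).symm.norm_map (a.flip v)).symm)
      (fun w hw => hnd w fun v => (hA v w).symm.trans (hw v))
    have ha : ∀ v₁ v₂, a v₁ v₂ = ⟪e v₂, v₁⟫ := fun v₁ v₂ => by rw [he, hA]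
    let S : V₁ →L[ℝ] Q := Cs ∘L (e.symm : V₁ →L[ℝ] V₂)
    obtain ⟨y, hy⟩ := exists_add_sq_smul_adjoint_apply_eq (S ∘L Iop.adjoint) t (-u)
    have hy' : y + t ^ 2 • Iop (S.adjoint (S (Iop.adjoint y))) = -u := by
      simpa [ContinuousLinearMap.adjoint_comp] using hy
    refine ⟨(-(t ^ 2 • S.adjoint (S (Iop.adjoint y))), t • e.symm (Iop.adjoint y)), fun φ => ?_⟩
    have hu : u = -y - t ^ 2 • Iop (S.adjoint (S (Iop.adjoint y))) := by
      rw [← neg_neg u, ← hy']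
      abel
    have hS : S (e φ.2) = Cs φ.2 := by simp [S]
    have hS' : Cs (e.symm (Iop.adjoint y)) = S (Iop.adjoint y) := rfl
    rw [ha, ha, hu]
    simp only [map_neg, map_smul, ContinuousLinearEquiv.apply_symm_apply, inner_neg_right,
      inner_neg_left, inner_sub_left, real_inner_smul_left, real_inner_smul_right,
      ContinuousLinearMap.adjoint_inner_left, ContinuousLinearMap.adjoint_inner_right, hS, hS']
    rw [real_inner_comm (Cs φ.2)]
    ring
  · rintro ⟨x₁, x₂⟩ ⟨z₁, z₂⟩ hx hz
    have hd : ∀ φ₁ φ₂, a (x₁ - z₁) φ₂ + a φ₁ (x₂ - z₂)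
        + t * (⟪Cs (x₂ - z₂), Cs φ₂⟫ - ⟪Iop (x₁ - z₁), Iop φ₁⟫) = 0 := fun φ₁ φ₂ => by
      have h := (hx (φ₁, φ₂)).trans (hz (φ₁, φ₂)).symm
      simp only [map_sub, inner_sub_left, sub_apply] at h ⊢
      linarith
    generalize hd₁ : x₁ - z₁ = d₁ at hd
    generalize hd₂ : x₂ - z₂ = d₂ at hd
    have h := hd (-d₁) d₂
    simp only [map_neg, neg_apply, inner_neg_right, sub_neg_eq_add,
      add_neg_cancel, zero_add, mul_eq_zero, ht.ne', false_or,
      real_inner_self_eq_norm_sq] at h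
    have hC : Cs d₂ = 0 := norm_eq_zero.1 (by nlinarith [sq_nonneg ‖Iop d₁‖, sq_nonneg ‖Cs d₂‖])
    have hI : Iop d₁ = 0 := norm_eq_zero.1 (by nlinarith [sq_nonneg ‖Iop d₁‖, sq_nonneg ‖Cs d₂‖])
    have h₁ : d₁ = 0 := hnd d₁ fun φ₂ => by simpa [hC, hI] using hd 0 φ₂
    have h₂ : a.flip d₂ = 0 := by
      ext φ₁
      simpa [hC, hI] using hd φ₁ 0
    have h₃ : d₂ = 0 := by
      have := hbelow d₂
      rw [h₂, norm_zero] at this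
      exact norm_le_zero_iff.1 (nonpos_of_mul_nonpos_right this hma_pos)
    rw [sub_eq_zero.1 (hd₁.trans h₁), sub_eq_zero.1 (hd₂.trans h₃)]
end
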